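/- arXiv:2105.01590 — 3 statements merged into one kernel-verified Lean document; each statement's English description precedes it below -/
import Mathlib

section
/- Let D > 0, t > 0, v ∈ ℝ, z₀ ∈ ℝ, z_S < z_E, S > 0, r₀ ≥ 0 and φ₀ ∈ ℝ. Then the integral of the concentration C_c over the cylinder {(r,φ,z) : 0 ≤ r ≤ S, 0 ≤ φ < 2π, z_S < z < z_E} in cylindrical coordinates satisfies ∫₀^S ∫₀^{2π} ∫_{z_S}^{z_E} C_c(r,φ,z) · r dz dφ dr = (1/2)·(erf((z₀ + v t − z_S)/√(4 D t)) − erf((z₀ + v t − z_E)/√(4 D t))) · exp(−r₀²/(4 D t)) · ∑_{k=0}^{∞} ((r₀²/(4 D t))^k / (k!)²) · ∫₀^{S²/(4 D t)} u^k e^{−u} du. -/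
open Real

/-- The Gaussian error function `erf x = (2/√π) ∫₀ˣ e^{-y²} dy`. -/
noncomputable def erf (x : ℝ) : ℝ := (2 / Real.sqrt π) * ∫ y in (0:ℝ)..x, Real.exp (-y ^ 2)

/-- The free-space Gaussian advection–diffusion concentration in cylindrical coordinates,
for diffusion coefficient `D`, flow velocity `v` (in z-direction), elapsed time `t` since
the point release at cylindrical position `(r₀, φ₀, z₀)`. -/
noncomputable def Cc (D t v r₀ φ₀ z₀ r φ z : ℝ) : ℝ :=
  ((4 * π * D * t) ^ ((3:ℝ) / 2))⁻¹ *
    Real.exp (-(r ^ 2 + r₀ ^ 2 - 2 * r₀ * r * Real.cos (φ - φ₀) + (z - z₀ - v * t) ^ 2)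
      / (4 * D * t))

lemma aux_cos_pow (n : ℕ) : ∫ φ in (0:ℝ)..(2 * π), cos φ ^ (n + 2)
    = (n + 1) / (n + 2) * ∫ φ in (0:ℝ)..(2 * π), cos φ ^ n := by
  rw [integral_cos_pow]
  simp

lemma aux_cos_pow_odd (k : ℕ) : ∫ φ in (0:ℝ)..(2 * π), cos φ ^ (2 * k + 1) = 0 := by
  induction k with
  | zero => simp
  | succ k ih =>
    rw [show 2 * (k + 1) + 1 = (2 * k + 1) + 2 by ring, aux_cos_pow, ih, mul_zero]

lemma aux_cos_pow_even (k : ℕ) : ∫ φ in (0:ℝ)..(2 * π), cos φ ^ (2 * k)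
    = 2 * π * ((2 * k).factorial / (4 ^ k * (k.factorial : ℝ) ^ 2)) := by
  induction k with
  | zero => simp
  | succ k ih =>
    rw [show 2 * (k + 1) = (2 * k) + 2 by ring, aux_cos_pow, ih]
    rw [show (2 * k) + 2 = (2 * k + 1) + 1 by ring]
    simp only [Nat.factorial_succ]
    push_cast
    have := Nat.factorial_ne_zero k
    have : (k:ℝ) + 1 ≠ 0 := by positivity
    field_simp
    ring

lemma aux_bessel_full (x : ℝ) : HasSum (fun n : ℕ => ∫ φ in (0:ℝ)..(2 * π), x ^ n / n.factorial * cos φ ^ n)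
    (∫ φ in (0:ℝ)..(2 * π), exp (x * cos φ)) := by
  apply intervalIntegral.hasSum_integral_of_dominated_convergence
    (bound := fun n _ => |x| ^ n / n.factorial)
  · intro n
    exact (by fun_prop : Continuous fun φ : ℝ => x ^ n / n.factorial * cos φ ^ n).aestronglyMeasurable
  · intro n
    refine Filter.Eventually.of_forall fun φ _ => ?_
    rw [norm_mul, norm_div, norm_pow, norm_pow, Real.norm_eq_abs, Real.norm_eq_abs, Real.norm_eq_abs,
      Nat.abs_cast]
    exact mul_le_of_le_one_right (by positivity) (pow_le_one₀ (abs_nonneg _) (abs_cos_le_one φ))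
  · exact Filter.Eventually.of_forall fun φ _ => Real.summable_pow_div_factorial |x|
  · exact intervalIntegrable_const
  · refine Filter.Eventually.of_forall fun φ _ => ?_
    have h := NormedSpace.expSeries_div_hasSum_exp (𝔸 := ℝ) (x * cos φ)
    rw [← Real.exp_eq_exp_ℝ] at h
    have e : (fun n : ℕ => x ^ n / n.factorial * cos φ ^ n)
        = fun n : ℕ => (x * cos φ) ^ n / n.factorial := by
      ext n
      rw [mul_pow]; ring
    rw [e]
    exact h

lemma aux_bessel (x φ₀ : ℝ) : HasSum (fun k : ℕ => 2 * π * ((x / 2) ^ (2 * k) / (k.factorial : ℝ) ^ 2))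
    (∫ φ in (0:ℝ)..(2 * π), exp (x * cos (φ - φ₀))) := by
  have hp : ∫ φ in (0:ℝ)..(2 * π), exp (x * cos (φ - φ₀)) = ∫ φ in (0:ℝ)..(2 * π), exp (x * cos φ) := by
    rw [intervalIntegral.integral_comp_sub_right (fun φ => exp (x * cos φ))]
    have hper : Function.Periodic (fun φ => exp (x * cos φ)) (2 * π) := fun φ => by simp
    have := hper.intervalIntegral_add_eq (0 - φ₀) 0
    rw [zero_add] at this
    rw [← this]
    congr 1
    ring
  rw [hp]
  have hinj : Function.Injective (fun k : ℕ => 2 * k) := fun a b h => by simpa using h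
  have h := (hinj.hasSum_iff (f := fun n : ℕ => ∫ φ in (0:ℝ)..(2 * π), x ^ n / n.factorial * cos φ ^ n)
    (a := ∫ φ in (0:ℝ)..(2 * π), exp (x * cos φ)) ?_).2 (aux_bessel_full x)
  · convert h using 2 with k
    simp only [Function.comp]
    rw [intervalIntegral.integral_const_mul, aux_cos_pow_even]
    have := Nat.factorial_ne_zero k
    have := Nat.factorial_ne_zero (2 * k)
    rw [div_pow, pow_mul 2]
    norm_num
    field_simp
  · intro n hn
    obtain ⟨k, rfl | rfl⟩ := Nat.even_or_odd' n
    · exact absurd ⟨k, rfl⟩ hn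
    · rw [intervalIntegral.integral_const_mul, aux_cos_pow_odd, mul_zero]

lemma aux_z (a m zS zE : ℝ) (ha : 0 < a) :
    ∫ z in zS..zE, exp (-(z - m) ^ 2 / a)
      = √a * (√π / 2 * (erf ((m - zS) / √a) - erf ((m - zE) / √a))) := by
  have hs : 0 < √a := Real.sqrt_pos.2 ha
  have hpi : 0 < √π := Real.sqrt_pos.2 pi_pos
  have hii : ∀ p q : ℝ, IntervalIntegrable (fun y : ℝ => exp (-y ^ 2)) MeasureTheory.volume p q :=
    fun p q => (by fun_prop : Continuous fun y : ℝ => exp (-y ^ 2)).intervalIntegrable p q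
  have h1 : ∀ z, exp (-(z - m) ^ 2 / a) = exp (-(m / √a - z / √a) ^ 2) := by
    intro z
    congr 1
    rw [← sub_div, div_pow, Real.sq_sqrt ha.le]
    ring
  simp only [h1]
  rw [intervalIntegral.integral_comp_sub_div (fun y => exp (-y ^ 2)) hs.ne']
  unfold erf
  rw [← mul_sub, intervalIntegral.integral_interval_sub_left (hii _ _) (hii _ _), sub_div, sub_div,
    smul_eq_mul]
  field_simp

lemma aux_radial (a S : ℝ) (ha : 0 < a) (k : ℕ) :
    ∫ r in (0:ℝ)..S, (r ^ 2 / a) ^ k * exp (-(r ^ 2 / a)) * r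
      = a / 2 * ∫ u in (0:ℝ)..(S ^ 2 / a), u ^ k * exp (-u) := by
  have h := intervalIntegral.integral_comp_mul_deriv (a := 0) (b := S) (f := fun r => r ^ 2 / a)
    (f' := fun r => 2 * r / a) (g := fun u => u ^ k * exp (-u))
    (fun r _ => by simpa using (hasDerivAt_pow 2 r).div_const a) (by fun_prop) (by fun_prop)
  simp only [Function.comp] at h
  rw [show (0:ℝ) ^ 2 / a = 0 by simp] at h
  rw [← h, ← intervalIntegral.integral_const_mul]
  congr 1
  ext r
  field_simp

lemma aux_main (a S r₀ : ℝ) (ha : 0 < a) (hS : 0 < S) (φ₀ : ℝ) :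
    HasSum (fun k : ℕ => π * a * (((r₀ ^ 2 / a) ^ k / ((Nat.factorial k : ℝ)) ^ 2)
            * ∫ u in (0:ℝ)..(S ^ 2 / a), u ^ k * Real.exp (-u)))
      (∫ r in (0:ℝ)..S, exp (-(r ^ 2 / a)) * r *
        ∫ φ in (0:ℝ)..(2 * π), exp (2 * r₀ * r / a * cos (φ - φ₀))) := by
  have key : ∀ k : ℕ, π * a * (((r₀ ^ 2 / a) ^ k / ((Nat.factorial k : ℝ)) ^ 2)
            * ∫ u in (0:ℝ)..(S ^ 2 / a), u ^ k * Real.exp (-u))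
      = ∫ r in (0:ℝ)..S, exp (-(r ^ 2 / a)) * r *
          (2 * π * ((2 * r₀ * r / a / 2) ^ (2 * k) / (k.factorial : ℝ) ^ 2)) := by
    intro k
    have : ∀ r, exp (-(r ^ 2 / a)) * r *
          (2 * π * ((2 * r₀ * r / a / 2) ^ (2 * k) / (k.factorial : ℝ) ^ 2))
        = (2 * π * ((r₀ ^ 2 / a) ^ k / (k.factorial : ℝ) ^ 2)) *
          ((r ^ 2 / a) ^ k * exp (-(r ^ 2 / a)) * r) := by
      intro r
      have : (2 * r₀ * r / a / 2) ^ (2 * k) = (r₀ ^ 2 / a) ^ k * (r ^ 2 / a) ^ k := by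
        rw [pow_mul, ← mul_pow]
        congr 1
        field_simp
      rw [this]
      ring
    simp only [this]
    rw [intervalIntegral.integral_const_mul, aux_radial a S ha]
    ring
  simp only [key]
  apply intervalIntegral.hasSum_integral_of_dominated_convergence
    (bound := fun k _ => S * (2 * π * ((2 * r₀ * S / a / 2) ^ (2 * k) / (k.factorial : ℝ) ^ 2)))
  · intro k
    exact (by fun_prop : Continuous fun r : ℝ => exp (-(r ^ 2 / a)) * r *
          (2 * π * ((2 * r₀ * r / a / 2) ^ (2 * k) / (k.factorial : ℝ) ^ 2))).aestronglyMeasurable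
  · intro k
    refine Filter.Eventually.of_forall fun r hr => ?_
    rw [Set.uIoc_of_le hS.le] at hr
    have hr0 := hr.1.le
    have hrS := hr.2
    have e1 : exp (-(r ^ 2 / a)) ≤ 1 := by
      rw [Real.exp_le_one_iff]
      have : 0 ≤ r ^ 2 / a := by positivity
      linarith
    have e2 : ∀ s : ℝ, (2 * r₀ * s / a / 2) ^ (2 * k) = ((r₀ / a) ^ 2 * s ^ 2) ^ k := by
      intro s
      rw [pow_mul]
      congr 1
      field_simp
    rw [e2, e2, Real.norm_of_nonneg (by positivity)]
    have : exp (-(r ^ 2 / a)) * r ≤ S := by nlinarith [exp_pos (-(r ^ 2 / a))]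
    gcongr
  · exact Filter.Eventually.of_forall fun r _ => (aux_bessel _ φ₀).summable.mul_left S
  · exact intervalIntegrable_const
  · exact Filter.Eventually.of_forall fun r _ => (aux_bessel _ φ₀).mul_left _

/-- Proposition 1: the channel impulse response of a transparent cylindrical receiver
for a point transmitter. The integral of the concentration `Cc` over the cylinder
`{(r,φ,z) : 0 ≤ r ≤ S, 0 ≤ φ < 2π, z_S < z < z_E}` in cylindrical coordinates equals
`(1/2)(erf((z₀+vt−z_S)/√(4Dt)) − erf((z₀+vt−z_E)/√(4Dt))) e^{−r₀²/(4Dt)}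
  ∑ₖ ((r₀²/(4Dt))ᵏ/(k!)²) γ(k+1, S²/(4Dt))`,
where `γ(k+1, x) = ∫₀ˣ uᵏ e^{−u} du` is the lower incomplete Gamma function. -/
theorem cir_cylindrical_receiver (D t v z₀ zS zE S r₀ φ₀ : ℝ)
    (hD : 0 < D) (ht : 0 < t) (hz : zS < zE) (hS : 0 < S) (hr₀ : 0 ≤ r₀) :
    (∫ r in (0:ℝ)..S, ∫ φ in (0:ℝ)..(2 * π), ∫ z in zS..zE,
        Cc D t v r₀ φ₀ z₀ r φ z * r)
      = (1 / 2) * (erf ((z₀ + v * t - zS) / Real.sqrt (4 * D * t))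
            - erf ((z₀ + v * t - zE) / Real.sqrt (4 * D * t)))
        * Real.exp (-r₀ ^ 2 / (4 * D * t))
        * ∑' k : ℕ, ((r₀ ^ 2 / (4 * D * t)) ^ k / ((Nat.factorial k : ℝ)) ^ 2)
            * ∫ u in (0:ℝ)..(S ^ 2 / (4 * D * t)), u ^ k * Real.exp (-u) := by
  have ha : 0 < 4 * D * t := by positivity
  have hC : ((4 * π * D * t) ^ ((3:ℝ) / 2)) = π * (4 * D * t) * (√(4 * D * t) * √π) := by
    rw [show 4 * π * D * t = π * (4 * D * t) by ring, show (3:ℝ) / 2 = 1 + 1 / 2 by norm_num,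
      Real.rpow_add (by positivity), Real.rpow_one, ← Real.sqrt_eq_rpow, Real.sqrt_mul pi_pos.le]
    ring
  unfold Cc
  rw [hC]
  generalize 4 * D * t = a at *
  have hs : 0 < √a := Real.sqrt_pos.2 ha
  have hpi : 0 < √π := Real.sqrt_pos.2 pi_pos
  have hpp := pi_pos
  have e : ∀ r φ z : ℝ, (π * a * (√a * √π))⁻¹ *
      exp (-(r ^ 2 + r₀ ^ 2 - 2 * r₀ * r * cos (φ - φ₀) + (z - z₀ - v * t) ^ 2) / a) * r
      = (π * a * (√a * √π))⁻¹ * exp (-r₀ ^ 2 / a) * (exp (-(r ^ 2 / a)) * r) *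
        exp (2 * r₀ * r / a * cos (φ - φ₀)) * exp (-(z - (z₀ + v * t)) ^ 2 / a) := by
    intro r φ z
    have : exp (-(r ^ 2 + r₀ ^ 2 - 2 * r₀ * r * cos (φ - φ₀) + (z - z₀ - v * t) ^ 2) / a)
      = exp (-r₀ ^ 2 / a) * exp (-(r ^ 2 / a)) *
        exp (2 * r₀ * r / a * cos (φ - φ₀)) * exp (-(z - (z₀ + v * t)) ^ 2 / a) := by
      rw [← exp_add, ← exp_add, ← exp_add]
      congr 1
      ring
    rw [this]
    ring
  simp only [e, intervalIntegral.integral_const_mul, intervalIntegral.integral_mul_const]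
  have hm := (aux_main a S r₀ ha hS φ₀).tsum_eq
  rw [tsum_mul_left] at hm
  simp only [mul_assoc, intervalIntegral.integral_const_mul, intervalIntegral.integral_mul_const] at hm ⊢
  rw [aux_z a _ _ _ ha]
  simp only [← mul_assoc, intervalIntegral.integral_const_mul, intervalIntegral.integral_mul_const] at hm ⊢
  rw [← hm]
  field_simp
end

section
/- Let D > 0, t > 0, v ∈ ℝ, z₀ ∈ ℝ, z_S < z_E and S > 0. If the release point lies on the cylinder axis (r₀ = 0), then ∫₀^S ∫₀^{2π} ∫_{z_S}^{z_E} (4 π D t)^{−3/2} · exp(−(r² + (z − z₀ − v t)²)/(4 D t)) · r dz dφ dr = (1/2)·(erf((z₀ + v t − z_S)/√(4 D t)) − erf((z₀ + v t − z_E)/√(4 D t))) · (1 − exp(−S²/(4 D t))). -/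
open Real

theorem cir_radial (a S : ℝ) (ha : 0 < a) :
    (∫ r in (0:ℝ)..S, Real.exp (-r ^ 2 / a) * r) = a / 2 * (1 - Real.exp (-S ^ 2 / a)) := by
  have h : ∀ x ∈ Set.uIcc (0:ℝ) S,
      HasDerivAt (fun r : ℝ => -(a / 2) * Real.exp (-r ^ 2 / a)) (Real.exp (-x ^ 2 / a) * x) x := by
    intro x _
    have h1 : HasDerivAt (fun r : ℝ => -r ^ 2 / a) (-(2 * x) / a) x := by
      have := ((hasDerivAt_pow 2 x).neg).div_const a
      simpa using this
    have h2 := (h1.exp).const_mul (-(a / 2))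
    refine h2.congr_deriv ?_
    have hne : a ≠ 0 := ha.ne'
    generalize Real.exp (-x ^ 2 / a) = e
    field_simp
  rw [intervalIntegral.integral_eq_sub_of_hasDerivAt h
    (Continuous.intervalIntegrable (by fun_prop) _ _)]
  simp
  ring

theorem cir_axial (a m zS zE : ℝ) (ha : 0 < a) :
    (∫ z in zS..zE, Real.exp (-(z - m) ^ 2 / a)) =
      Real.sqrt a * (Real.sqrt π / 2) *
        (erf ((m - zS) / Real.sqrt a) - erf ((m - zE) / Real.sqrt a)) := by
  have hs : 0 < Real.sqrt a := Real.sqrt_pos.2 ha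
  have hp : 0 < Real.sqrt π := Real.sqrt_pos.2 Real.pi_pos
  have hsq : Real.sqrt a ^ 2 = a := Real.sq_sqrt ha.le
  have h1 : (∫ z in zS..zE, Real.exp (-(z - m) ^ 2 / a)) =
      ∫ z in zS..zE, (fun y : ℝ => Real.exp (-y ^ 2)) (m / Real.sqrt a - z / Real.sqrt a) := by
    congr 1
    ext z
    simp only
    rw [← sub_div, div_pow, hsq]
    congr 1
    ring
  rw [h1, intervalIntegral.integral_comp_sub_div (fun y : ℝ => Real.exp (-y ^ 2)) hs.ne', ← sub_div, ← sub_div]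
  have hi : ∀ x y : ℝ, IntervalIntegrable (fun y : ℝ => Real.exp (-y ^ 2)) MeasureTheory.volume x y :=
    fun x y => Continuous.intervalIntegrable (by fun_prop) _ _
  unfold erf
  rw [← mul_sub, intervalIntegral.integral_interval_sub_left (hi _ _) (hi _ _), smul_eq_mul]
  field_simp

/-- The special case of the channel impulse response of Proposition 1 for the desired
transmitter located directly opposite its receiver (`r₀ = 0`), where the Bessel series
reduces to the single term `γ(1, S²/(4Dt)) = 1 − e^{−S²/(4Dt)}`. -/
theorem cir_on_axis (D t v z₀ zS zE S : ℝ)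
    (hD : 0 < D) (ht : 0 < t) (hz : zS < zE) (hS : 0 < S) :
    (∫ r in (0:ℝ)..S, ∫ φ in (0:ℝ)..(2 * π), ∫ z in zS..zE,
        ((4 * π * D * t) ^ ((3:ℝ) / 2))⁻¹ *
          Real.exp (-(r ^ 2 + (z - z₀ - v * t) ^ 2) / (4 * D * t)) * r)
      = (1 / 2) * (erf ((z₀ + v * t - zS) / Real.sqrt (4 * D * t))
            - erf ((z₀ + v * t - zE) / Real.sqrt (4 * D * t)))
        * (1 - Real.exp (-S ^ 2 / (4 * D * t))) := by
  have ha : 0 < 4 * D * t := by positivity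
  have hC : (4 * π * D * t) ^ ((3:ℝ) / 2) =
      π * (4 * D * t) * (Real.sqrt π * Real.sqrt (4 * D * t)) := by
    have hx : 0 < π * (4 * D * t) := by positivity
    rw [← Real.sqrt_mul Real.pi_pos.le, show 4 * π * D * t = π * (4 * D * t) by ring,
      show (3:ℝ) / 2 = 1 + 1 / 2 by norm_num, Real.rpow_add hx, Real.rpow_one, Real.sqrt_eq_rpow]
  rw [hC]
  have hz' := cir_axial (4 * D * t) (z₀ + v * t) zS zE ha
  have hr := cir_radial (4 * D * t) S ha
  generalize 4 * D * t = a at *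
  have key : ∀ r z : ℝ, (π * a * (Real.sqrt π * Real.sqrt a))⁻¹ *
      Real.exp (-(r ^ 2 + (z - z₀ - v * t) ^ 2) / a) * r =
      ((π * a * (Real.sqrt π * Real.sqrt a))⁻¹ * (Real.exp (-r ^ 2 / a) * r)) *
        Real.exp (-(z - (z₀ + v * t)) ^ 2 / a) := by
    intro r z
    rw [show -(r ^ 2 + (z - z₀ - v * t) ^ 2) / a =
      -r ^ 2 / a + -(z - (z₀ + v * t)) ^ 2 / a by ring, Real.exp_add]
    ring
  simp only [key, intervalIntegral.integral_const_mul, intervalIntegral.integral_mul_const,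
    intervalIntegral.integral_const, smul_eq_mul, hz', hr]
  have hs : 0 < Real.sqrt a := Real.sqrt_pos.2 ha
  have hp : 0 < Real.sqrt π := Real.sqrt_pos.2 Real.pi_pos
  have hpi := Real.pi_pos
  field_simp
  ring
end

section
/- Let m ≥ 1, c > 0, and μ : Fin m → ℝ with μ_i ≥ 0 for all i. Define A(n) = ∑_i (c + μ_i)^n · e^{−(c + μ_i)} and B(n) = ∑_i μ_i^n · e^{−μ_i} for n ∈ ℕ (with 0^0 = 1). Then there exists N ∈ ℕ such that A(n) ≥ B(n) for all n ≥ N. -/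
open Real Finset

/-- Existence of a finite detection threshold: with `A n = ∑ᵢ (c+μᵢ)ⁿ e^{−(c+μᵢ)}` and
`B n = ∑ᵢ μᵢⁿ e^{−μᵢ}` (convention `0⁰ = 1`), the decision set `{n : A n ≥ B n}` of the
ML detector contains all sufficiently large `n`. -/
theorem ml_threshold_exists (m : ℕ) (hm : 1 ≤ m) (c : ℝ) (hc : 0 < c)
    (μ : Fin m → ℝ) (hμ : ∀ i, 0 ≤ μ i) :
    ∃ N : ℕ, ∀ n : ℕ, N ≤ n →
      (∑ i, (c + μ i) ^ n * Real.exp (-(c + μ i)))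
        ≥ (∑ i, (μ i) ^ n * Real.exp (-(μ i))) := by
  have key : ∀ i, ∀ᶠ n : ℕ in Filter.atTop,
      (μ i) ^ n * Real.exp (-(μ i)) ≤ (c + μ i) ^ n * Real.exp (-(c + μ i)) := by
    intro i
    have hp : 0 < c + μ i := by linarith [hμ i]
    have h1 : μ i / (c + μ i) < 1 := by
      rw [div_lt_one hp]
      linarith
    have ht := tendsto_pow_atTop_nhds_zero_of_lt_one (div_nonneg (hμ i) hp.le) h1
    filter_upwards [ht.eventually_lt_const (Real.exp_pos (-c))] with n hn
    rw [div_pow, div_lt_iff₀ (pow_pos hp n)] at hn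
    have he : Real.exp (-(c + μ i)) = Real.exp (-c) * Real.exp (-(μ i)) := by
      rw [← Real.exp_add]
      congr 1
      ring
    rw [he]
    have := mul_le_mul_of_nonneg_right hn.le (Real.exp_pos (-(μ i))).le
    linarith
  obtain ⟨N, hN⟩ := Filter.eventually_atTop.1 (Filter.eventually_all.2 key)
  exact ⟨N, fun n hn => Finset.sum_le_sum fun i _ => hN n hn i⟩
end
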